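/- Suppose there exists u ∈ ℝ^d with ⟨Cu,u⟩ > 0, and suppose t > 0 is such that for every real x and every λ ≥ 1, (Φ⁻¹(S_α(λx)))² ≥ (Φ⁻¹(S_α(x)))². Then inf{ |y|²/2 : y ∈ ℝ^d, ⟨C·S_α⁻¹(Φ(y)), S_α⁻¹(Φ(y))⟩ ≥ t } = (1/2)·inf{ Σ_{i=1}^d (Φ⁻¹(S_α(√t·u_i)))² : u ∈ ℝ^d, ⟨Cu,u⟩ = 1 }. -/

import Mathlib

open MeasureTheory Filter Set
open scoped Topology

noncomputable section

/-- The standard normal cumulative distribution function `Φ`. -/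
def normCDF (y : ℝ) : ℝ := ∫ u in Iic y, Real.exp (-u ^ 2 / 2) / Real.sqrt (2 * Real.pi)

/-- The quadratic form `⟨Cx, x⟩`. -/
def quadForm {d : ℕ} (C : Matrix (Fin d) (Fin d) ℝ) (x : Fin d → ℝ) : ℝ :=
  ∑ i, (∑ j, C i j * x j) * x i

theorem integrable_normDensity :
    Integrable (fun u : ℝ => Real.exp (-u ^ 2 / 2) / Real.sqrt (2 * Real.pi)) := by
  have h := (integrable_exp_neg_mul_sq (b := 1 / 2) (by norm_num)).div_const
    (Real.sqrt (2 * Real.pi))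
  refine h.congr (Eventually.of_forall fun u => ?_)
  simp only
  ring_nf

theorem integral_normDensity :
    ∫ u : ℝ, Real.exp (-u ^ 2 / 2) / Real.sqrt (2 * Real.pi) = 1 := by
  have h := integral_gaussian (1 / 2)
  have hexp : ∀ u : ℝ, -u ^ 2 / 2 = -(1 / 2) * u ^ 2 := fun u => by ring
  simp_rw [hexp]
  rw [integral_div, h, show Real.pi / (1 / 2) = 2 * Real.pi by ring]
  exact div_self (by positivity)

theorem setIntegral_normDensity_pos {s : Set ℝ} (hs : volume s ≠ 0) :
    0 < ∫ u in s, Real.exp (-u ^ 2 / 2) / Real.sqrt (2 * Real.pi) := by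
  have hpos : ∀ u : ℝ, 0 < Real.exp (-u ^ 2 / 2) / Real.sqrt (2 * Real.pi) :=
    fun u => by positivity
  rw [setIntegral_pos_iff_support_of_nonneg_ae (Eventually.of_forall fun u => (hpos u).le)
    integrable_normDensity.integrableOn]
  have hsupp : Function.support
      (fun u : ℝ => Real.exp (-u ^ 2 / 2) / Real.sqrt (2 * Real.pi)) = univ :=
    Set.eq_univ_of_forall fun u => (hpos u).ne'
  rw [hsupp, univ_inter]
  exact pos_iff_ne_zero.mpr hs

theorem normCDF_strictMono : StrictMono normCDF := by
  intro a b hab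
  have h := intervalIntegral.integral_Iic_sub_Iic
    (integrable_normDensity.integrableOn (s := Iic a))
    (integrable_normDensity.integrableOn (s := Iic b))
  rw [intervalIntegral.integral_of_le hab.le] at h
  have hpos := setIntegral_normDensity_pos (s := Ioc a b) (by simpa using hab)
  unfold normCDF
  linarith

theorem normCDF_mem_Ioo (y : ℝ) : normCDF y ∈ Ioo (0 : ℝ) 1 := by
  have h := intervalIntegral.integral_Iic_add_Ioi
    (integrable_normDensity.integrableOn (s := Iic y))
    (integrable_normDensity.integrableOn (s := Ioi y))
  rw [integral_normDensity] at h
  have hIic := setIntegral_normDensity_pos (s := Iic y) (by simp)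
  have hIoi := setIntegral_normDensity_pos (s := Ioi y) (by simp)
  unfold normCDF
  exact ⟨hIic, by linarith⟩

theorem quadForm_smul {d : ℕ} (C : Matrix (Fin d) (Fin d) ℝ) (c : ℝ) (x : Fin d → ℝ) :
    quadForm C (fun i => c * x i) = c ^ 2 * quadForm C x := by
  simp only [quadForm, Finset.mul_sum, Finset.sum_mul]
  exact Finset.sum_congr rfl fun i _ => Finset.sum_congr rfl fun j _ => by ring

theorem quadForm_normalize {d : ℕ} (C : Matrix (Fin d) (Fin d) ℝ) {x : Fin d → ℝ}
    (hx : 0 < quadForm C x) :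
    quadForm C (fun i => (Real.sqrt (quadForm C x))⁻¹ * x i) = 1 := by
  rw [quadForm_smul, inv_pow, Real.sq_sqrt hx.le, inv_mul_cancel₀ hx.ne']

/-- The variational identity from the proof of Proposition 8.2.4:
`inf{ |y|²/2 : ⟨C S_α⁻¹(Φ(y)), S_α⁻¹(Φ(y))⟩ ≥ t }
  = (1/2) inf{ Σ_i (Φ⁻¹(S_α(√t u_i)))² : ⟨Cu,u⟩ = 1 }`. -/
theorem inf_I_on_Bt_eq
    {d : ℕ}
    (α : ℝ) (hα : 0 < α)
    (sα Sα Sαinv : ℝ → ℝ)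
    (hs_cont : Continuous sα) (hs_pos : ∀ x, 0 < sα x)
    (hSα : ∀ x, Sα x = ∫ u in Iic x, sα u)
    (hrange : ∀ x, Sα x ∈ Ioo (0 : ℝ) 1)
    (hinv_left : ∀ x, Sαinv (Sα x) = x)
    (hinv_right : ∀ p ∈ Ioo (0 : ℝ) 1, Sα (Sαinv p) = p)
    (Φinv : ℝ → ℝ) (hΦinv : ∀ p ∈ Ioo (0 : ℝ) 1, normCDF (Φinv p) = p)
    (C : Matrix (Fin d) (Fin d) ℝ)
    (hpos : ∃ u : Fin d → ℝ, 0 < quadForm C u)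
    (t : ℝ) (ht : 0 < t)
    (hmono : ∀ x lam : ℝ, 1 ≤ lam → (Φinv (Sα x)) ^ 2 ≤ (Φinv (Sα (lam * x))) ^ 2) :
    sInf {r : ℝ | ∃ y : Fin d → ℝ,
        t ≤ quadForm C (fun i => Sαinv (normCDF (y i))) ∧ r = (∑ i, y i ^ 2) / 2} =
      (1 / 2) * sInf {r : ℝ | ∃ u : Fin d → ℝ,
        quadForm C u = 1 ∧ r = ∑ i, (Φinv (Sα (Real.sqrt t * u i))) ^ 2} := by
  have hΦinv_left : ∀ y, Φinv (normCDF y) = y := fun y =>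
    normCDF_strictMono.injective (hΦinv _ (normCDF_mem_Ioo y))
  set A := {r : ℝ | ∃ y : Fin d → ℝ,
    t ≤ quadForm C (fun i => Sαinv (normCDF (y i))) ∧ r = (∑ i, y i ^ 2) / 2}
  set B := {r : ℝ | ∃ u : Fin d → ℝ,
    quadForm C u = 1 ∧ r = ∑ i, (Φinv (Sα (Real.sqrt t * u i))) ^ 2}
  have hA_bdd : BddBelow A := by
    refine ⟨0, ?_⟩
    rintro r ⟨y, -, rfl⟩
    positivity
  have hB_bdd : BddBelow B := by
    refine ⟨0, ?_⟩
    rintro r ⟨u, -, rfl⟩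
    positivity
  have hBA : ∀ r ∈ B, r / 2 ∈ A := by
    rintro r ⟨u, hu, rfl⟩
    refine ⟨fun i => Φinv (Sα (Real.sqrt t * u i)), ?_, rfl⟩
    simp only [hΦinv _ (hrange _), hinv_left]
    rw [quadForm_smul, hu, Real.sq_sqrt ht.le, mul_one]
  have hAB : ∀ r ∈ A, ∃ r' ∈ B, r' / 2 ≤ r := by
    rintro r ⟨y, hy, rfl⟩
    set x : Fin d → ℝ := fun i => Sαinv (normCDF (y i)) with hx
    have hq : 0 < quadForm C x := ht.trans_le hy
    have hst : 0 < Real.sqrt t := Real.sqrt_pos.mpr ht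
    have hsq : 0 < Real.sqrt (quadForm C x) := Real.sqrt_pos.mpr hq
    refine ⟨_, ⟨_, quadForm_normalize C hq, rfl⟩, ?_⟩
    refine div_le_div_of_nonneg_right (Finset.sum_le_sum fun i _ => ?_) zero_le_two
    have hlam : 1 ≤ Real.sqrt (quadForm C x) / Real.sqrt t :=
      (one_le_div hst).mpr (Real.sqrt_le_sqrt hy)
    have h := hmono (Real.sqrt t * ((Real.sqrt (quadForm C x))⁻¹ * x i)) _ hlam
    have hscale : Real.sqrt (quadForm C x) / Real.sqrt t *
        (Real.sqrt t * ((Real.sqrt (quadForm C x))⁻¹ * x i)) = x i := by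
      field_simp
    have hxy : Φinv (Sα (x i)) = y i := by
      rw [hx, hinv_right _ (normCDF_mem_Ioo _), hΦinv_left]
    rwa [hscale, hxy] at h
  obtain ⟨u, hu⟩ := hpos
  have hB_ne : B.Nonempty := ⟨_, _, quadForm_normalize C hu, rfl⟩
  have hA_ne : A.Nonempty := hB_ne.elim fun r hr => ⟨_, hBA r hr⟩
  apply le_antisymm
  · have h : 2 * sInf A ≤ sInf B := le_csInf hB_ne fun r hr => by
      linarith [csInf_le hA_bdd (hBA r hr)]
    linarith
  · refine le_csInf hA_ne fun r hr => ?_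
    obtain ⟨r', hr', hle⟩ := hAB r hr
    linarith [csInf_le hB_bdd hr']

end
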